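/- Let P and Q be probability distributions on finite sets, neither of which is a uniform distribution (so V(P) > 0 and V(Q) > 0), with H(P)/V(P) = H(Q)/V(Q), and let b ∈ ℝ. Then lim_{n→∞} F^D(P^n → Q^{⌊(H(P)/H(Q))n + b√n⌋}) = lim_{n→∞} F^M(P^n → Q^{⌊(H(P)/H(Q))n + b√n⌋}) = exp(−(H(Q)b)²/(8 V(P))) if b > 0, and = 1 if b ≤ 0 (in particular both limits exist). -/

import Mathlib

open MeasureTheory Filter

namespace RNG

variable {α β : Type*}

/-- `P` is a probability distribution on the finite set `α`. -/
def IsProb [Fintype α] (P : α → ℝ) : Prop :=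
  (∀ x, 0 ≤ P x) ∧ ∑ x, P x = 1

open Classical in
/-- Pushforward distribution `W(P)(y) = ∑_{x : W x = y} P x`. -/
noncomputable def push [Fintype α] (W : α → β) (P : α → ℝ) : β → ℝ :=
  fun y => ∑ x, if W x = y then P x else 0

/-- Fidelity (Bhattacharyya coefficient) between distributions on the same finite set. -/
noncomputable def fid [Fintype β] (R S : β → ℝ) : ℝ :=
  ∑ y, Real.sqrt (R y * S y)

/-- Sum of the `l` largest values of `P`, i.e. the `l`-th partial sum of the
decreasing rearrangement of `P` (padded with zeros). -/
noncomputable def topSum [Fintype α] (P : α → ℝ) (l : ℕ) : ℝ :=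
  sSup {s : ℝ | ∃ A : Finset α, A.card ≤ l ∧ s = ∑ x ∈ A, P x}

/-- Majorization `P ≺ P'` (the distributions may live on different finite sets). -/
def Maj [Fintype α] [Fintype β] (P : α → ℝ) (P' : β → ℝ) : Prop :=
  ∀ l : ℕ, topSum P l ≤ topSum P' l

/-- Maximal fidelity under deterministic transformations,
`F^D(P → Q) = max {F(W(P), Q) | W : α → β}`. -/
noncomputable def FD [Fintype α] [Fintype β] (P : α → ℝ) (Q : β → ℝ) : ℝ :=
  sSup {r : ℝ | ∃ W : α → β, r = fid (push W P) Q}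

/-- Maximal fidelity under the majorization condition,
`F^M(P → Q) = max {F(P', Q) | P ≺ P', P'` a distribution on the target set`}`. -/
noncomputable def FM [Fintype α] [Fintype β] (P : α → ℝ) (Q : β → ℝ) : ℝ :=
  sSup {r : ℝ | ∃ P' : β → ℝ, IsProb P' ∧ Maj P P' ∧ r = fid P' Q}

/-- Shannon entropy (natural logarithm). -/
noncomputable def H [Fintype α] (P : α → ℝ) : ℝ := ∑ x, -(P x * Real.log (P x))

/-- Varentropy `V(P)` (natural logarithm). -/
noncomputable def V [Fintype α] (P : α → ℝ) : ℝ :=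
  ∑ x, P x * (-Real.log (P x) - H P) ^ 2

/-- Shannon entropy, base-2 logarithm. -/
noncomputable def H2 [Fintype α] (P : α → ℝ) : ℝ := ∑ x, -(P x * Real.logb 2 (P x))

/-- Varentropy, base-2 logarithm. -/
noncomputable def V2 [Fintype α] (P : α → ℝ) : ℝ :=
  ∑ x, P x * (-Real.logb 2 (P x) - H2 P) ^ 2

/-- The `n`-fold i.i.d. product distribution `P^n`. -/
noncomputable def iid [Fintype α] (P : α → ℝ) (n : ℕ) : (Fin n → α) → ℝ :=
  fun f => ∏ i, P (f i)

/-- The uniform distribution on a two-element set. -/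
noncomputable def U2 : Fin 2 → ℝ := fun _ => 1 / 2

/-- Density of the normal distribution `N(m, v)`. -/
noncomputable def normalPDF (m v t : ℝ) : ℝ :=
  (Real.sqrt (2 * Real.pi * v))⁻¹ * Real.exp (-(t - m) ^ 2 / (2 * v))

/-- Standard normal cumulative distribution function `G`. -/
noncomputable def stdG (x : ℝ) : ℝ := ∫ t in Set.Iic x, normalPDF 0 1 t

/-- Density `N_P` of `N(0, V(P))`. -/
noncomputable def NP [Fintype α] (P : α → ℝ) (x : ℝ) : ℝ := normalPDF 0 (V P) x

/-- Density `N_{P,Q,b}` of `N(H(Q)b, (H(P)/H(Q))·V(Q))`. -/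
noncomputable def NPQ [Fintype α] [Fintype β] (P : α → ℝ) (Q : β → ℝ) (b x : ℝ) : ℝ :=
  normalPDF (H Q * b) (H P / H Q * V Q) x

/-- Cdf `G_P(x) = G(x/√V(P))`. -/
noncomputable def GP [Fintype α] (P : α → ℝ) (x : ℝ) : ℝ := stdG (x / Real.sqrt (V P))

/-- Cdf `G_{P,Q,b}(x) = G(√(H(Q)/(H(P)V(Q)))·(x − H(Q)b))`. -/
noncomputable def GPQ [Fintype α] [Fintype β] (P : α → ℝ) (Q : β → ℝ) (b x : ℝ) : ℝ :=
  stdG (Real.sqrt (H Q / (H P * V Q)) * (x - H Q * b))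

/-- `I_{P,Q,b}(x) = ∫_{−∞}^x √(N_P(t) N_{P,Q,b}(t)) dt`. -/
noncomputable def IPQ [Fintype α] [Fintype β] (P : α → ℝ) (Q : β → ℝ) (b x : ℝ) : ℝ :=
  ∫ t in Set.Iic x, Real.sqrt (NP P t * NPQ P Q b t)

/-- `I_{P,Q,b}(∞) = ∫_ℝ √(N_P(t) N_{P,Q,b}(t)) dt`. -/
noncomputable def IPQinf [Fintype α] [Fintype β] (P : α → ℝ) (Q : β → ℝ) (b : ℝ) : ℝ :=
  ∫ t : ℝ, Real.sqrt (NP P t * NPQ P Q b t)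

/-- `L^D_n(P,Q|ν)`: the maximal `L` with `F^D(P^n → Q^L) ≥ ν`. -/
noncomputable def LD [Fintype α] [Fintype β] (P : α → ℝ) (Q : β → ℝ) (ν : ℝ) (n : ℕ) : ℕ :=
  sSup {L : ℕ | ν ≤ FD (iid P n) (iid Q L)}

/-- The optimal second order rate `R^D_2(P,Q|ν)`. -/
noncomputable def RD2 [Fintype α] [Fintype β] (P : α → ℝ) (Q : β → ℝ) (ν : ℝ) : ℝ :=
  sSup {b : ℝ | ∃ c : ℝ, ν ≤ c ∧
    Tendsto (fun n : ℕ =>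
      FD (iid P n) (iid Q (⌊H P / H Q * n + b * Real.sqrt n⌋₊))) atTop (nhds c)}

section Asymptotics

open Asymptotics Topology

theorem tendsto_one_add_pow_exp {z : ℕ → ℂ} {k : ℕ → ℕ} {s : ℂ}
    (hz : Tendsto z atTop (𝓝 0)) (h : Tendsto (fun n => (k n : ℂ) * z n) atTop (𝓝 s)) :
    Tendsto (fun n => (1 + z n) ^ k n) atTop (𝓝 (Complex.exp s)) := by
  have hlog : Tendsto (fun n => (k n : ℂ) * Complex.log (1 + z n)) atTop (𝓝 s) := by
    have h1 : (fun n => (k n : ℂ) * (Complex.log (1 + z n) - z n)) =O[atTop]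
        fun n => ((k n : ℂ) * z n) * z n := by
      have := (isBigO_refl (fun n => (k n : ℂ)) atTop).mul
        (Complex.log_sub_self_isBigO.comp_tendsto hz)
      refine this.congr_right fun n => ?_
      simp only [Function.comp]
      ring
    have h2 := h1.trans_tendsto (by simpa using h.mul hz)
    simpa [mul_sub] using h2.add h
  refine ((Complex.continuous_exp.tendsto s).comp hlog).congr' ?_
  filter_upwards [hz.eventually_ne (show (0 : ℂ) ≠ -1 by simp)] with n hn
  have : 1 + z n ≠ 0 := fun h0 => hn (by linear_combination h0)
  simp [Complex.exp_nat_mul, Complex.exp_log this]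

theorem tendsto_natCast_mul_exp_sub {u : ℕ → ℂ} {k : ℕ → ℕ} {s : ℂ}
    (hu : Tendsto u atTop (𝓝 0)) (h : Tendsto (fun n => (k n : ℂ) * u n ^ 2) atTop (𝓝 s)) :
    Tendsto (fun n => (k n : ℂ) * (Complex.exp (u n) - 1 - u n)) atTop (𝓝 (s / 2)) := by
  have h1 : (fun n => (k n : ℂ) * (Complex.exp (u n) - 1 - u n - u n ^ 2 / 2)) =O[atTop]
      fun n => ((k n : ℂ) * u n ^ 2) * u n := by
    have := (isBigO_refl (fun n => (k n : ℂ)) atTop).mul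
      ((Complex.exp_sub_sum_range_isBigO_pow 3).comp_tendsto hu)
    refine this.congr (fun n => ?_) fun n => ?_
    · simp only [Function.comp, Finset.sum_range_succ, Finset.sum_range_zero, Nat.factorial]
      push_cast
      ring
    · simp only [Function.comp]
      ring
  have h2 := (h1.trans_tendsto (by simpa using h.mul hu)).add (h.div_const 2)
  rw [zero_add] at h2
  exact h2.congr fun n => by ring

/-- Moment generating functions of normalized sums of centered finite random variables converge
to those of a Gaussian. -/
theorem tendsto_mgf_pow {Z : Type*} [Fintype Z] {R : Z → ℝ} (hR : IsProb R) {a : Z → ℝ} {v : ℝ}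
    (ha : ∑ z, R z * a z = 0) (hv : ∑ z, R z * a z ^ 2 = v) {w : ℕ → ℂ} {k : ℕ → ℕ} {s : ℂ}
    (hw : Tendsto w atTop (𝓝 0)) (h : Tendsto (fun n => (k n : ℂ) * w n ^ 2) atTop (𝓝 s)) :
    Tendsto (fun n => (∑ z, (R z : ℂ) * Complex.exp (w n * a z)) ^ k n) atTop
      (𝓝 (Complex.exp (v * s / 2))) := by
  have hsplit : ∀ n, ∑ z, (R z : ℂ) * Complex.exp (w n * a z)
      = 1 + ∑ z, (R z : ℂ) * (Complex.exp (w n * a z) - 1 - w n * a z) := by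
    intro n
    have h1 : ∑ z, (R z : ℂ) = 1 := by exact_mod_cast hR.2
    have h2 : ∑ z, (R z : ℂ) * a z = 0 := by exact_mod_cast ha
    have h3 : ∑ z, (R z : ℂ) * (w n * a z) = 0 := by
      rw [← mul_zero (w n), ← h2, Finset.mul_sum]
      exact Finset.sum_congr rfl fun _ _ => by ring
    simp only [mul_sub, Finset.sum_sub_distrib, h3, mul_one, h1]
    ring
  simp only [hsplit]
  have hwa : ∀ z, Tendsto (fun n => w n * a z) atTop (𝓝 0) := fun z => by
    simpa using hw.mul_const (a z : ℂ)
  refine tendsto_one_add_pow_exp ?_ ?_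
  · rw [show (0 : ℂ) = ∑ z, (R z : ℂ) * (Complex.exp 0 - 1 - 0) by simp]
    exact tendsto_finsetSum _ fun z _ => Tendsto.const_mul _
      ((((Complex.continuous_exp.tendsto 0).comp (hwa z)).sub_const 1).sub (hwa z))
  · have hv' : (v : ℂ) * s / 2 = ∑ z, (R z : ℂ) * ((a z : ℂ) ^ 2 * s / 2) := by
      rw [← hv]
      push_cast
      rw [Finset.sum_mul, Finset.sum_div]
      exact Finset.sum_congr rfl fun _ _ => by ring
    rw [hv']
    simp only [Finset.mul_sum]
    refine tendsto_finsetSum _ fun z _ => ?_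
    have := (tendsto_natCast_mul_exp_sub (hwa z) (k := k) (s := (a z : ℂ) ^ 2 * s)
      ((h.const_mul ((a z : ℂ) ^ 2)).congr fun n => by ring)).const_mul (R z : ℂ)
    exact this.congr fun n => by ring

end Asymptotics

section CentralLimit

open Topology ProbabilityTheory

variable {Z : Type*} [Fintype Z]

theorem iid_nonneg {R : Z → ℝ} (hR : IsProb R) (n : ℕ) (y : Fin n → Z) : 0 ≤ iid R n y :=
  Finset.prod_nonneg fun i _ => hR.1 (y i)

theorem isProb_iid {R : Z → ℝ} (hR : IsProb R) (n : ℕ) : IsProb (iid R n) := by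
  refine ⟨iid_nonneg hR n, ?_⟩
  simp only [iid]
  rw [← Fintype.sum_pow, hR.2, one_pow]

/-- Centered information content of a letter. -/
noncomputable def info (R : Z → ℝ) (z : Z) : ℝ := -Real.log (R z) - H R

theorem sum_mul_info {R : Z → ℝ} (hR : IsProb R) : ∑ z, R z * info R z = 0 := by
  simp only [info, mul_sub, Finset.sum_sub_distrib, ← Finset.sum_mul, hR.2, one_mul, mul_neg]
  simp [H]

theorem sum_mul_info_sq (R : Z → ℝ) : ∑ z, R z * info R z ^ 2 = V R := rfl

theorem sum_iid_mul_exp (R a : Z → ℝ) (n : ℕ) (w : ℂ) :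
    ∑ y : Fin n → Z, (iid R n y : ℂ) * Complex.exp (w * (∑ i, a (y i) : ℝ))
      = (∑ z, (R z : ℂ) * Complex.exp (w * a z)) ^ n := by
  rw [Fintype.sum_pow]
  refine Finset.sum_congr rfl fun y _ => ?_
  rw [Finset.prod_mul_distrib, ← Complex.exp_sum]
  simp [iid, Finset.mul_sum]

/-- The law of a real function under a finite distribution. -/
noncomputable def law (R f : Z → ℝ) : Measure ℝ :=
  ∑ z, ENNReal.ofReal (R z) • Measure.dirac (f z)

theorem isProbabilityMeasure_law {R : Z → ℝ} (hR : IsProb R) (f : Z → ℝ) :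
    IsProbabilityMeasure (law R f) := by
  constructor
  simp [law, ← ENNReal.ofReal_sum_of_nonneg fun z _ => hR.1 z, hR.2]

theorem charFun_law {R : Z → ℝ} (hR : IsProb R) (f : Z → ℝ) (t : ℝ) :
    charFun (law R f) t = ∑ z, (R z : ℂ) * Complex.exp (t * Complex.I * f z) := by
  rw [charFun_apply_real, law, integral_finsetSum_measure]
  · refine Finset.sum_congr rfl fun z _ => ?_
    rw [integral_smul_measure, integral_dirac, ENNReal.toReal_ofReal (hR.1 z), Complex.real_smul]
    congr 2
    ring
  · intro z _
    exact (integrable_dirac (by simp)).smul_measure ENNReal.ofReal_ne_top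

open Classical in
theorem law_real {R : Z → ℝ} (hR : IsProb R) (f : Z → ℝ) {s : Set ℝ} (hs : MeasurableSet s) :
    (law R f).real s = ∑ z with f z ∈ s, R z := by
  simp only [law, Measure.real, Measure.finsetSum_apply, Measure.smul_apply, smul_eq_mul,
    Measure.dirac_apply' _ hs]
  rw [ENNReal.toReal_sum fun z _ => ENNReal.mul_ne_top ENNReal.ofReal_ne_top (by
    by_cases h : f z ∈ s <;> simp [h]), Finset.sum_filter]
  refine Finset.sum_congr rfl fun z _ => ?_
  by_cases h : f z ∈ s <;> simp [h, hR.1 z]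

/-- Central limit theorem for the information content, for `k n` letters on the scale `√n`. -/
theorem tendsto_sum_iid_Ico {R : Z → ℝ} (hR : IsProb R) {k : ℕ → ℕ} {κ : ℝ} {v : NNReal}
    (hk : Tendsto (fun n => (k n : ℝ) / n) atTop (𝓝 κ)) (hv : (v : ℝ) = κ * V R) (hv0 : v ≠ 0)
    {c : ℕ → ℝ} {m : ℝ} (hc : Tendsto c atTop (𝓝 m)) (x y : ℝ) :
    Tendsto (fun n : ℕ => ∑ f : Fin (k n) → Z with
        (∑ i, info R (f i)) / √n + c n ∈ Set.Ico x y, iid R (k n) f) atTop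
      (𝓝 ((gaussianReal m v).real (Set.Ico x y))) := by
  have : ∀ n, IsProbabilityMeasure
      (law (iid R (k n)) fun f => (∑ i, info R (f i)) / √n + c n) := fun n =>
    isProbabilityMeasure_law (isProb_iid hR _) _
  let μ : ℕ → ProbabilityMeasure ℝ := fun n =>
    ⟨law (iid R (k n)) fun f => (∑ i, info R (f i)) / √n + c n, this n⟩
  let μ₀ : ProbabilityMeasure ℝ := ⟨gaussianReal m v, inferInstance⟩
  have hμ : Tendsto μ atTop (𝓝 μ₀) := by
    refine ProbabilityMeasure.tendsto_of_tendsto_charFun fun t => ?_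
    change Tendsto (fun n => charFun
      (law (iid R (k n)) fun f => (∑ i, info R (f i)) / √n + c n) t) _
      (𝓝 (charFun (gaussianReal m v) t))
    rw [charFun_gaussianReal]
    have hw : Tendsto (fun n : ℕ => (t * Complex.I) * ((√(n : ℝ))⁻¹ : ℝ)) atTop (𝓝 0) := by
      have : Tendsto (fun n : ℕ => (√(n : ℝ))⁻¹) atTop (𝓝 0) :=
        tendsto_inv_atTop_zero.comp (Real.tendsto_sqrt_atTop.comp tendsto_natCast_atTop_atTop)
      have := (Complex.continuous_ofReal.tendsto 0).comp this
      simpa using this.const_mul (t * Complex.I)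
    have hkw : Tendsto (fun n : ℕ => (k n : ℂ) * ((t * Complex.I) * ((√(n : ℝ))⁻¹ : ℝ)) ^ 2) atTop
        (𝓝 (-(t : ℂ) ^ 2 * κ)) := by
      refine (((Complex.continuous_ofReal.tendsto _).comp hk).const_mul
        (-(t : ℂ) ^ 2)).congr fun n => ?_
      simp only [Function.comp]
      rw [mul_pow, mul_pow, Complex.I_sq, ← Complex.ofReal_pow (√(n : ℝ))⁻¹, inv_pow,
        Real.sq_sqrt (Nat.cast_nonneg n)]
      push_cast
      ring
    have h1 := tendsto_mgf_pow hR (sum_mul_info hR) (sum_mul_info_sq R) hw hkw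
    have h2 : Tendsto (fun n => Complex.exp (t * Complex.I * c n)) atTop
        (𝓝 (Complex.exp (t * Complex.I * m))) :=
      (Complex.continuous_exp.tendsto _).comp
        (((Complex.continuous_ofReal.tendsto _).comp hc).const_mul _)
    have h3 := h1.mul h2
    rw [← Complex.exp_add] at h3
    have hlim : (V R : ℂ) * (-(t : ℂ) ^ 2 * κ) / 2 + t * Complex.I * m
        = t * m * Complex.I - v * t ^ 2 / 2 := by
      have : (v : ℂ) = κ * V R := by exact_mod_cast congrArg Complex.ofReal hv
      rw [this]
      ring
    rw [hlim] at h3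
    refine h3.congr fun n => ?_
    rw [charFun_law (isProb_iid hR _), ← sum_iid_mul_exp, Finset.sum_mul]
    refine Finset.sum_congr rfl fun f _ => ?_
    rw [mul_assoc, ← Complex.exp_add]
    congr 2
    push_cast
    ring
  have hfr : μ₀ (frontier (Set.Ico x y)) = 0 := by
    have := nullSingletonClass_gaussianReal (μ := m) hv0
    have h0 : gaussianReal m v (frontier (Set.Ico x y)) = 0 := by
      by_cases hxy : x < y
      · rw [frontier_Ico hxy]
        exact (Set.toFinite _).measure_zero _
      · rw [Set.Ico_eq_empty hxy, frontier_empty, measure_empty]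
    rw [ProbabilityMeasure.coeFn_def]
    simp [μ₀, h0]
  have := (NNReal.continuous_coe.tendsto _).comp
    (ProbabilityMeasure.tendsto_measure_of_null_frontier_of_tendsto hμ hfr)
  refine this.congr fun n => ?_
  have h := law_real (isProb_iid hR (k n)) (fun f => (∑ i, info R (f i)) / √n + c n)
    (measurableSet_Ico (a := x) (b := y))
  change (law _ _).real _ = _
  rw [h]
  exact Finset.sum_congr (by ext; simp) fun _ _ => rfl

end CentralLimit

section Filling

theorem exists_subset_sum_between {P : α → ℝ} {η r : ℝ} (hr : 0 ≤ r) (S : Finset α)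
    (hη : ∀ x ∈ S, P x ≤ η) (hη0 : 0 ≤ η) (hS : r ≤ ∑ x ∈ S, P x) :
    ∃ A ⊆ S, ∑ x ∈ A, P x ≤ r ∧ r - η ≤ ∑ x ∈ A, P x := by
  classical
  induction S using Finset.induction_on with
  | empty => exact ⟨∅, subset_rfl, by simpa using hr, by simp at hS ⊢; linarith⟩
  | insert x S hx ih =>
    by_cases h : r ≤ ∑ x ∈ S, P x
    · obtain ⟨A, hA, h1, h2⟩ := ih (fun z hz => hη z (Finset.mem_insert_of_mem hz)) h
      exact ⟨A, hA.trans (Finset.subset_insert _ _), h1, h2⟩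
    · rw [Finset.sum_insert hx] at hS
      have := hη x (Finset.mem_insert_self _ _)
      exact ⟨S, Finset.subset_insert _ _, by linarith, by linarith⟩

/-- Greedy filling: small atoms can be distributed so as to fill every bin `y` up to `η y`. -/
theorem exists_map_filling [Nonempty β] [DecidableEq β] {P : α → ℝ} (hP : ∀ x, 0 ≤ P x)
    {r η : β → ℝ} (hr : ∀ y, 0 ≤ r y) (hη0 : ∀ y, 0 ≤ η y) (T : Finset β) (S : Finset α)
    (hη : ∀ x ∈ S, ∀ y ∈ T, P x ≤ η y ∨ r y = 0) (hS : ∑ y ∈ T, r y ≤ ∑ x ∈ S, P x) :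
    ∃ W : α → β, ∀ y ∈ T, r y - η y ≤ ∑ x ∈ S with W x = y, P x := by
  classical
  induction T using Finset.induction_on generalizing S with
  | empty => exact ⟨fun _ => Classical.arbitrary β, by simp⟩
  | insert y T hy ih =>
    rw [Finset.sum_insert hy] at hS
    have hT : 0 ≤ ∑ y ∈ T, r y := Finset.sum_nonneg fun y _ => hr y
    obtain ⟨A, hAS, hA1, hA2⟩ : ∃ A ⊆ S, ∑ x ∈ A, P x ≤ r y ∧ r y - η y ≤ ∑ x ∈ A, P x := by
      by_cases h0 : r y = 0
      · exact ⟨∅, Finset.empty_subset _, by simp [h0], by simpa [h0] using hη0 y⟩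
      · exact exists_subset_sum_between (hr y) S (fun x hx =>
          (hη x hx y (Finset.mem_insert_self _ _)).resolve_right h0) (hη0 y) (by linarith)
    have hsd := Finset.sum_sdiff (f := P) hAS
    obtain ⟨W, hW⟩ := ih (S \ A) (fun x hx z hz =>
      hη x (Finset.sdiff_subset hx) z (Finset.mem_insert_of_mem hz)) (by linarith)
    refine ⟨fun x => if x ∈ A then y else W x, fun z hz => ?_⟩
    rcases Finset.mem_insert.1 hz with rfl | hz
    · refine hA2.trans (Finset.sum_le_sum_of_subset_of_nonneg (fun x hx => ?_) fun x _ _ => hP x)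
      simp [hx, hAS hx]
    · refine (hW z hz).trans
        (Finset.sum_le_sum_of_subset_of_nonneg (fun x hx => ?_) fun x _ _ => hP x)
      simp only [Finset.mem_filter, Finset.mem_sdiff] at hx ⊢
      exact ⟨hx.1.1, by simp [hx.1.2, hx.2]⟩

theorem push_nonneg [Fintype α] {P : α → ℝ} (hP : ∀ x, 0 ≤ P x) (W : α → β) (y : β) :
    0 ≤ push W P y := by
  unfold push
  exact Finset.sum_nonneg fun x _ => by split_ifs <;> simp [hP]

theorem isProb_push [Fintype α] [Fintype β] {P : α → ℝ} (hP : IsProb P) (W : α → β) :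
    IsProb (push W P) := by
  refine ⟨push_nonneg hP.1 W, ?_⟩
  unfold push
  rw [Finset.sum_comm, ← hP.2]
  exact Finset.sum_congr rfl fun x _ =>
    (Fintype.sum_eq_single (W x) fun y hy => if_neg hy.symm).trans (if_pos rfl)

theorem fid_le_one [Fintype β] {R S : β → ℝ} (hR : IsProb R) (hS : IsProb S) : fid R S ≤ 1 := by
  calc fid R S ≤ ∑ y, (R y + S y) / 2 := Finset.sum_le_sum fun y _ => by
        rw [Real.sqrt_le_left (by linarith [hR.1 y, hS.1 y])]
        nlinarith [sq_nonneg (R y - S y)]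
    _ = 1 := by rw [← Finset.sum_div, Finset.sum_add_distrib, hR.2, hS.2]; norm_num

theorem fid_nonneg [Fintype β] (R S : β → ℝ) : 0 ≤ fid R S :=
  Finset.sum_nonneg fun _ _ => Real.sqrt_nonneg _

theorem fid_push_le_FD [Fintype α] [Fintype β] {P : α → ℝ} {Q : β → ℝ} (hP : IsProb P)
    (hQ : IsProb Q) (W : α → β) :
    fid (push W P) Q ≤ FD P Q :=
  le_csSup ⟨1, by rintro _ ⟨W, rfl⟩; exact fid_le_one (isProb_push hP W) hQ⟩ ⟨W, rfl⟩

/-- Lower bound on `FD` from a decomposition of both alphabets into matched blocks in which the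
atoms of `P` are small compared with those of `Q`. -/
theorem sum_sqrt_le_FD [Fintype α] [Fintype β] {P : α → ℝ} {Q : β → ℝ} (hP : IsProb P)
    (hQ : IsProb Q) (f : α → ℤ) (g : β → ℤ) (I : Finset ℤ) {ε : ℝ} (hε : 0 ≤ ε)
    (h : ∀ x y, f x = g y → P x ≤ ε * Q y ∨ Q y = 0) :
    ∑ k ∈ I, √((∑ y with g y = k, Q y) * ((∑ x with f x = k, P x) - ε * ∑ y with g y = k, Q y))
      ≤ FD P Q := by
  classical
  have hne : Nonempty β := by
    by_contra hne
    rw [not_nonempty_iff] at hne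
    simpa using hQ.2
  set p : ℤ → ℝ := fun k => ∑ x with f x = k, P x with hp
  set q : ℤ → ℝ := fun k => ∑ y with g y = k, Q y with hq
  have hp0 : ∀ k, 0 ≤ p k := fun k => Finset.sum_nonneg fun x _ => hP.1 x
  have hq0 : ∀ k, 0 ≤ q k := fun k => Finset.sum_nonneg fun y _ => hQ.1 y
  have hW : ∀ k : ℤ, ∃ W : α → β, ∀ y ∈ ({y | g y = k} : Finset β),
      Q y * (p k / q k) - ε * Q y ≤ ∑ x ∈ ({x | f x = k} : Finset α) with W x = y, P x := by
    intro k
    refine exists_map_filling hP.1 (r := fun y => Q y * (p k / q k)) (η := fun y => ε * Q y)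
      (fun y => mul_nonneg (hQ.1 y) (div_nonneg (hp0 k) (hq0 k)))
      (fun y => mul_nonneg hε (hQ.1 y)) _ _ ?_ ?_
    · intro x hx y hy
      simp only [Finset.mem_filter, Finset.mem_univ, true_and] at hx hy
      exact (h x y (hx.trans hy.symm)).imp id fun h0 => by simp [h0]
    · rw [← Finset.sum_mul]
      change q k * (p k / q k) ≤ p k
      rcases eq_or_ne (q k) 0 with h0 | h0
      · simpa [h0] using hp0 k
      · rw [mul_div_cancel₀ _ h0]
  choose W hW using hW
  refine le_trans ?_ (fid_push_le_FD hP hQ fun x => W (f x) x)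
  have hblock : ∀ k, √(q k * (p k - ε * q k)) ≤
      ∑ y with g y = k, √(push (fun x => W (f x) x) P y * Q y) := by
    intro k
    calc √(q k * (p k - ε * q k)) = ∑ y with g y = k, Q y * √(p k / q k - ε) := by
          rw [← Finset.sum_mul]
          change _ = q k * _
          rcases eq_or_ne (q k) 0 with h0 | h0
          · simp [h0]
          · rw [show q k * (p k - ε * q k) = q k ^ 2 * (p k / q k - ε) by field_simp,
              Real.sqrt_mul (sq_nonneg _), Real.sqrt_sq (hq0 k)]
      _ ≤ _ := by
          refine Finset.sum_le_sum fun y hy => ?_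
          have hy' : g y = k := by simpa using hy
          calc Q y * √(p k / q k - ε) = √(Q y ^ 2 * (p k / q k - ε)) := by
                rw [Real.sqrt_mul (sq_nonneg _), Real.sqrt_sq (hQ.1 y)]
            _ ≤ _ := Real.sqrt_le_sqrt ?_
          have h1 : ∑ x ∈ ({x | f x = k} : Finset α) with W k x = y, P x
              ≤ push (fun x => W (f x) x) P y := by
            unfold push
            rw [← Finset.sum_filter]
            refine Finset.sum_le_sum_of_subset_of_nonneg (fun x hx => ?_) fun x _ _ => hP.1 x
            simp only [Finset.mem_filter, Finset.mem_univ, true_and] at hx ⊢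
            rw [hx.1, hx.2]
          nlinarith [hW k y hy, hQ.1 y]
  calc _ ≤ ∑ k ∈ I, ∑ y with g y = k, √(push (fun x => W (f x) x) P y * Q y) :=
        Finset.sum_le_sum fun k _ => hblock k
    _ = ∑ y with g y ∈ I, √(push (fun x => W (f x) x) P y * Q y) := by
        rw [Finset.sum_fiberwise_eq_sum_filter]
    _ ≤ _ := Finset.sum_le_sum_of_subset_of_nonneg (Finset.subset_univ _)
        fun _ _ _ => Real.sqrt_nonneg _

end Filling

section Majorization

theorem sum_le_topSum [Fintype α] {P : α → ℝ} (hP : ∀ x, 0 ≤ P x) {l : ℕ} {A : Finset α}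
    (hA : A.card ≤ l) : ∑ x ∈ A, P x ≤ topSum P l :=
  le_csSup ⟨∑ x, P x, by
    rintro _ ⟨B, -, rfl⟩
    exact Finset.sum_le_sum_of_subset_of_nonneg (Finset.subset_univ _) fun x _ _ => hP x⟩
    ⟨A, hA, rfl⟩

theorem topSum_le [Fintype α] {P : α → ℝ} {l : ℕ} {c : ℝ}
    (h : ∀ A : Finset α, A.card ≤ l → ∑ x ∈ A, P x ≤ c) : topSum P l ≤ c :=
  csSup_le ⟨0, ∅, by simp, by simp⟩ (by rintro _ ⟨A, hA, rfl⟩; exact h A hA)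

theorem maj_push [Fintype α] [Fintype β] {P : α → ℝ} (hP : ∀ x, 0 ≤ P x) (W : α → β) :
    Maj P (push W P) := by
  classical
  refine fun l => topSum_le fun A hA => ?_
  refine le_trans ?_ (sum_le_topSum (A := A.image W) (push_nonneg hP W)
    (Finset.card_image_le.trans hA))
  unfold push
  rw [Finset.sum_comm]
  refine (Finset.sum_le_sum fun x hx => ?_).trans
    (Finset.sum_le_sum_of_subset_of_nonneg (Finset.subset_univ A) fun x _ _ =>
      Finset.sum_nonneg fun y _ => by split_ifs <;> simp [hP])
  rw [Finset.sum_eq_single_of_mem (W x) (Finset.mem_image_of_mem _ hx)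
    fun y _ hy => if_neg hy.symm, if_pos rfl]

theorem FD_le_FM [Fintype α] [Fintype β] {P : α → ℝ} {Q : β → ℝ} (hP : IsProb P)
    (hQ : IsProb Q) : FD P Q ≤ FM P Q := by
  refine Real.sSup_le ?_ (Real.sSup_nonneg ?_)
  · rintro _ ⟨W, rfl⟩
    exact le_csSup ⟨1, by rintro _ ⟨P', hP', -, rfl⟩; exact fid_le_one hP' hQ⟩
      ⟨push W P, isProb_push hP W, maj_push hP.1 W, rfl⟩
  · rintro _ ⟨P', -, -, rfl⟩
    exact fid_nonneg _ _

theorem FM_le [Fintype α] [Fintype β] {P : α → ℝ} {Q : β → ℝ} {c : ℝ} (hc : 0 ≤ c)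
    (h : ∀ P' : β → ℝ, IsProb P' → Maj P P' → fid P' Q ≤ c) : FM P Q ≤ c :=
  Real.sSup_le (by rintro _ ⟨P', h1, h2, rfl⟩; exact h P' h1 h2) hc

theorem Maj.sum_max_sub_le [Fintype α] [Fintype β] {P : α → ℝ} {P' : β → ℝ} (h : Maj P P')
    (hP : ∀ x, 0 ≤ P x) {s : ℝ} (hs : 0 ≤ s) :
    ∑ x, max (P x - s) 0 ≤ ∑ y, max (P' y - s) 0 := by
  classical
  set A : Finset α := {x | s ≤ P x} with hA
  have h1 : ∑ x, max (P x - s) 0 = ∑ x ∈ A, P x - A.card * s := by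
    rw [hA, Finset.card_eq_sum_ones, Nat.cast_sum, Finset.sum_mul, ← Finset.sum_sub_distrib,
      Finset.sum_filter]
    refine Finset.sum_congr rfl fun x _ => ?_
    split_ifs with hx
    · simp [hx]
    · simp [(not_le.1 hx).le]
  have h2 : topSum P' A.card ≤ ∑ y, max (P' y - s) 0 + A.card * s := by
    refine topSum_le fun B hB => ?_
    have hB' : (B.card : ℝ) * s ≤ A.card * s :=
      mul_le_mul_of_nonneg_right (by exact_mod_cast hB) hs
    calc ∑ y ∈ B, P' y ≤ ∑ y ∈ B, (max (P' y - s) 0 + s) :=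
          Finset.sum_le_sum fun y _ => by linarith [le_max_left (P' y - s) 0]
      _ = ∑ y ∈ B, max (P' y - s) 0 + B.card * s := by simp [Finset.sum_add_distrib]
      _ ≤ _ := add_le_add (Finset.sum_le_sum_of_subset_of_nonneg (Finset.subset_univ B)
          fun y _ _ => le_max_right _ _) hB'
  linarith [sum_le_topSum (A := A) hP le_rfl, h A.card]

theorem Maj.sum_min_le [Fintype α] [Fintype β] {P : α → ℝ} {P' : β → ℝ} (h : Maj P P')
    (hP : IsProb P) (hP' : IsProb P') {s : ℝ} (hs : 0 ≤ s) :
    ∑ y, min (P' y) s ≤ ∑ x, min (P x) s := by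
  have hmin : ∀ p : ℝ, min p s = p - max (p - s) 0 := fun p => by
    rcases le_total p s with h | h <;> simp [h]
  simp only [hmin, Finset.sum_sub_distrib, hP.2, hP'.2]
  linarith [h.sum_max_sub_le hP.1 hs]

theorem hasIntegral_min_mul_rpow {a p : ℝ} (ha0 : 0 < a) (ha1 : a < 1) (hp0 : 0 ≤ p)
    (hp1 : p ≤ 1) :
    IntervalIntegrable (fun s : ℝ => min p s * s ^ (a - 2)) volume 0 1 ∧
      p ^ a = a * p + a * (1 - a) * ∫ s in (0 : ℝ)..1, min p s * s ^ (a - 2) := by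
  rcases hp0.eq_or_lt with rfl | hp
  · have h0 : Set.EqOn (fun _ : ℝ => (0 : ℝ)) (fun s : ℝ => min 0 s * s ^ (a - 2))
        (Set.uIcc 0 1) := fun s hs => by
      rw [Set.uIcc_of_le zero_le_one] at hs
      simp [min_eq_left hs.1]
    refine ⟨IntervalIntegrable.congr_uIoo intervalIntegrable_const
      (h0.mono Set.uIoo_subset_uIcc_self), ?_⟩
    rw [← intervalIntegral.integral_congr h0]
    simp [ha0.ne']
  · have e1 : Set.EqOn (fun s : ℝ => s ^ (a - 1)) (fun s : ℝ => min p s * s ^ (a - 2))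
        (Set.uIoo 0 p) := fun s hs => by
      rw [Set.uIoo_of_le hp.le] at hs
      simp only [min_eq_right hs.2.le]
      rw [← Real.rpow_one_add' hs.1.le (by linarith)]
      congr 1
      ring
    have e2 : Set.EqOn (fun s : ℝ => p * s ^ (a - 2)) (fun s : ℝ => min p s * s ^ (a - 2))
        (Set.uIoo p 1) := fun s hs => by
      rw [Set.uIoo_of_le hp1] at hs
      simp only [min_eq_left hs.1.le]
    have hn : (0 : ℝ) ∉ Set.uIcc p 1 := by
      rw [Set.uIcc_of_le hp1]
      exact fun h => hp.not_ge h.1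
    have i1 := IntervalIntegrable.congr_uIoo
      (intervalIntegral.intervalIntegrable_rpow' (a := 0) (b := p)
      (show -1 < a - 1 by linarith)) e1
    have i2 := IntervalIntegrable.congr_uIoo
      ((intervalIntegral.intervalIntegrable_rpow (μ := volume) (r := a - 2)
      (Or.inr hn)).const_mul p) e2
    refine ⟨i1.trans i2, ?_⟩
    rw [← intervalIntegral.integral_add_adjacent_intervals i1 i2,
      ← intervalIntegral.integral_congr_uIoo e1, ← intervalIntegral.integral_congr_uIoo e2,
      intervalIntegral.integral_const_mul, integral_rpow (Or.inl (by linarith)),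
      integral_rpow (Or.inr ⟨by linarith, hn⟩), sub_add_cancel, Real.zero_rpow ha0.ne',
      show a - 2 + 1 = a - 1 by ring, Real.one_rpow, Real.rpow_sub_one hp.ne']
    have : a - 1 ≠ 0 := by linarith
    field_simp
    ring

theorem sum_rpow_eq_integral [Fintype α] {R : α → ℝ} (hR : IsProb R) {a : ℝ} (ha0 : 0 < a)
    (ha1 : a < 1) :
    IntervalIntegrable (fun s : ℝ => ∑ z, min (R z) s * s ^ (a - 2)) volume 0 1 ∧
      ∑ z, R z ^ a = a + a * (1 - a) * ∫ s in (0 : ℝ)..1, ∑ z, min (R z) s * s ^ (a - 2) := by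
  have h1 : ∀ z, R z ≤ 1 := fun z =>
    hR.2 ▸ Finset.single_le_sum (fun z _ => hR.1 z) (Finset.mem_univ z)
  have hI := fun z => hasIntegral_min_mul_rpow ha0 ha1 (hR.1 z) (h1 z)
  refine ⟨by
    simpa only [Finset.sum_fn] using IntervalIntegrable.sum Finset.univ fun z _ => (hI z).1, ?_⟩
  rw [intervalIntegral.integral_finsetSum fun z _ => (hI z).1, Finset.sum_congr rfl
    fun z _ => (hI z).2, Finset.sum_add_distrib, ← Finset.mul_sum, hR.2, mul_one, Finset.mul_sum]

/-- Schur concavity of `∑ P ^ a` for `0 < a < 1`. -/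
theorem Maj.sum_rpow_le [Fintype α] [Fintype β] {P : α → ℝ} {P' : β → ℝ} (h : Maj P P')
    (hP : IsProb P) (hP' : IsProb P') {a : ℝ} (ha0 : 0 < a) (ha1 : a < 1) :
    ∑ y, P' y ^ a ≤ ∑ x, P x ^ a := by
  have key := sum_rpow_eq_integral hP ha0 ha1
  have key' := sum_rpow_eq_integral hP' ha0 ha1
  rw [key.2, key'.2]
  have : 0 ≤ a * (1 - a) := mul_nonneg ha0.le (by linarith)
  gcongr
  refine intervalIntegral.integral_mono_on zero_le_one key'.1 key.1 fun s hs => ?_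
  rw [← Finset.sum_mul, ← Finset.sum_mul]
  exact mul_le_mul_of_nonneg_right (h.sum_min_le hP hP' hs.1) (Real.rpow_nonneg hs.1 _)

theorem fid_le_rpow_mul_rpow [Fintype β] {R S : β → ℝ} (hR : ∀ y, 0 ≤ R y) (hS : ∀ y, 0 ≤ S y)
    {u : ℝ} (hu0 : 0 < u) (hu1 : u < 1) :
    fid R S ≤ (∑ y, R y ^ (1 / (1 + u))) ^ ((1 + u) / 2) *
      (∑ y, S y ^ (1 / (1 - u))) ^ ((1 - u) / 2) := by
  have h1 : 0 < 1 - u := by linarith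
  have hc : Real.HolderConjugate (2 / (1 + u)) (2 / (1 - u)) := by
    refine Real.holderConjugate_iff.2 ⟨?_, ?_⟩
    · rw [lt_div_iff₀ (by linarith)]
      linarith
    · field_simp
      ring
  have h := Real.inner_le_Lp_mul_Lq Finset.univ (fun y => √(R y)) (fun y => √(S y)) hc
  have hpow : ∀ {x : ℝ} (e : ℝ), 0 ≤ x → |√x| ^ (2 / e) = x ^ (1 / e) := fun {x} e hx => by
    rw [abs_of_nonneg (Real.sqrt_nonneg x), Real.sqrt_eq_rpow, ← Real.rpow_mul hx]
    congr 1
    ring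
  simp only [hpow _ (hR _), hpow _ (hS _), one_div_div] at h
  simpa only [fid, Real.sqrt_mul (hR _)] using h

theorem FM_le_rpow_mul_rpow [Fintype α] [Fintype β] {P : α → ℝ} {Q : β → ℝ} (hP : IsProb P)
    (hQ : IsProb Q) {u : ℝ} (hu0 : 0 < u) (hu1 : u < 1) :
    FM P Q ≤ (∑ x, P x ^ (1 / (1 + u))) ^ ((1 + u) / 2) *
      (∑ y, Q y ^ (1 / (1 - u))) ^ ((1 - u) / 2) := by
  have hP0 : 0 ≤ ∑ x, P x ^ (1 / (1 + u)) :=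
    Finset.sum_nonneg fun x _ => Real.rpow_nonneg (hP.1 x) _
  have hQ0 : 0 ≤ ∑ y, Q y ^ (1 / (1 - u)) :=
    Finset.sum_nonneg fun x _ => Real.rpow_nonneg (hQ.1 x) _
  refine FM_le (by positivity) fun P' hP' h => ?_
  refine (fid_le_rpow_mul_rpow hP'.1 hQ.1 hu0 hu1).trans ?_
  have h0 : 0 ≤ ∑ y, P' y ^ (1 / (1 + u)) :=
    Finset.sum_nonneg fun x _ => Real.rpow_nonneg (hP'.1 x) _
  have := h.sum_rpow_le hP hP' (a := 1 / (1 + u)) (by positivity)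
    (by rw [div_lt_one (by linarith)]; linarith)
  gcongr

theorem FM_le_one [Fintype α] [Fintype β] (P : α → ℝ) {Q : β → ℝ} (hQ : IsProb Q) :
    FM P Q ≤ 1 :=
  FM_le zero_le_one fun _ hP' _ => fid_le_one hP' hQ

end Majorization

section UpperBound

open Topology

theorem tendsto_sqrt_natCast : Tendsto (fun n : ℕ => √(n : ℝ)) atTop atTop :=
  Real.tendsto_sqrt_atTop.comp tendsto_natCast_atTop_atTop

theorem tendsto_real_mgf_pow {Z : Type*} [Fintype Z] {R : Z → ℝ} (hR : IsProb R) {w : ℕ → ℝ}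
    {k : ℕ → ℕ} {s : ℝ} (hw : Tendsto w atTop (𝓝 0))
    (h : Tendsto (fun n => (k n : ℝ) * w n ^ 2) atTop (𝓝 s)) :
    Tendsto (fun n => (∑ z, R z * Real.exp (w n * info R z)) ^ k n) atTop
      (𝓝 (Real.exp (V R * s / 2))) := by
  have hw' : Tendsto (fun n => (w n : ℂ)) atTop (𝓝 0) := by
    have := (Complex.continuous_ofReal.tendsto 0).comp hw
    rw [Complex.ofReal_zero] at this
    exact this
  have h' : Tendsto (fun n => (k n : ℂ) * (w n : ℂ) ^ 2) atTop (𝓝 (s : ℂ)) :=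
    ((Complex.continuous_ofReal.tendsto s).comp h).congr fun n => by simp
  have := tendsto_mgf_pow hR (sum_mul_info hR) (sum_mul_info_sq R) hw' h'
  rw [← Filter.tendsto_ofReal_iff]
  push_cast
  exact this

theorem sum_iid_rpow {Z : Type*} [Fintype Z] {R : Z → ℝ} (hR : IsProb R) (n : ℕ) {w : ℝ}
    (hw : w < 1) :
    ∑ y, iid R n y ^ (1 - w)
      = Real.exp (n * w * H R) * (∑ z, R z * Real.exp (w * info R z)) ^ n := by
  have h1 : ∀ z, R z ^ (1 - w) = Real.exp (w * H R) * (R z * Real.exp (w * info R z)) := by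
    intro z
    rcases (hR.1 z).eq_or_lt with h0 | h0
    · rw [← h0, Real.zero_rpow (by linarith)]
      simp
    · nth_rewrite 2 [← Real.exp_log h0]
      rw [Real.rpow_def_of_pos h0, ← Real.exp_add, ← Real.exp_add, info]
      congr 1
      ring
  calc ∑ y, iid R n y ^ (1 - w) = ∑ y : Fin n → Z, ∏ i, R (y i) ^ (1 - w) :=
        Finset.sum_congr rfl fun y _ => (Real.finsetProd_rpow _ _ (fun i _ => hR.1 _) _).symm
    _ = (∑ z, R z ^ (1 - w)) ^ n := (Fintype.sum_pow (fun z => R z ^ (1 - w)) n).symm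
    _ = _ := by
        simp only [h1]
        rw [← Finset.mul_sum, mul_pow, ← Real.exp_nat_mul, mul_assoc (n : ℝ)]

/-- Asymptotic upper bound on `FM` with free tilting parameter `t`. -/
theorem exists_tendsto_FM_le {X Y : Type*} [Fintype X] [Fintype Y] {P : X → ℝ} {Q : Y → ℝ}
    (hP : IsProb P) (hQ : IsProb Q) {L : ℕ → ℕ} {κ m t : ℝ} (ht : 0 < t)
    (hL : Tendsto (fun n => (L n : ℝ) / n) atTop (𝓝 κ))
    (hm : Tendsto (fun n : ℕ => (L n * H Q - n * H P) / √n) atTop (𝓝 m)) :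
    ∃ B : ℕ → ℝ,
      Tendsto B atTop (𝓝 (Real.exp (-(t * m) / 2 + (V P + κ * V Q) * t ^ 2 / 4))) ∧
      ∀ᶠ n in atTop, FM (iid P n) (iid Q (L n)) ≤ B n := by
  set u : ℕ → ℝ := fun n => t / √n with hu
  have hu0 : Tendsto u atTop (𝓝 0) := tendsto_const_nhds.div_atTop tendsto_sqrt_natCast
  have hup : Tendsto (fun n => 1 + u n) atTop (𝓝 1) := by simpa using hu0.const_add 1
  have hum : Tendsto (fun n => 1 - u n) atTop (𝓝 1) := by simpa using hu0.const_sub 1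
  set wP : ℕ → ℝ := fun n => u n / (1 + u n) with hwP
  set wQ : ℕ → ℝ := fun n => -u n / (1 - u n) with hwQ
  have hwP0 : Tendsto wP atTop (𝓝 0) := by
    have := hu0.div hup one_ne_zero
    rw [zero_div] at this
    exact this
  have hwQ0 : Tendsto wQ atTop (𝓝 0) := by
    have := hu0.neg.div hum one_ne_zero
    rw [neg_zero, zero_div] at this
    exact this
  have hsP : Tendsto (fun n : ℕ => (n : ℝ) * wP n ^ 2) atTop (𝓝 (t ^ 2)) := by
    have : Tendsto (fun n => t ^ 2 / (1 + u n) ^ 2) atTop (𝓝 (t ^ 2)) := by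
      have := (tendsto_const_nhds (x := t ^ 2)).div (hup.pow 2) (by simp)
      rw [one_pow, div_one] at this
      exact this
    refine this.congr' ?_
    filter_upwards [eventually_gt_atTop 0] with n hn
    have hn' : (0 : ℝ) < n := by exact_mod_cast hn
    rw [hwP, hu]
    simp only [div_pow, Real.sq_sqrt hn'.le]
    field_simp
  have hsQ : Tendsto (fun n : ℕ => (L n : ℝ) * wQ n ^ 2) atTop (𝓝 (κ * t ^ 2)) := by
    have : Tendsto (fun n => (L n : ℝ) / n * (t ^ 2 / (1 - u n) ^ 2)) atTop (𝓝 (κ * t ^ 2)) := by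
      simpa using hL.mul ((tendsto_const_nhds (x := t ^ 2)).div (hum.pow 2) (by simp))
    refine this.congr' ?_
    filter_upwards [eventually_gt_atTop 0] with n hn
    have hn' : (0 : ℝ) < n := by exact_mod_cast hn
    rw [hwQ, hu]
    simp only [div_pow, neg_sq, Real.sq_sqrt hn'.le]
    ring
  have hZ := tendsto_real_mgf_pow hP hwP0 hsP
  have hY := tendsto_real_mgf_pow hQ hwQ0 hsQ
  set Z : ℕ → ℝ := fun n => (∑ z, P z * Real.exp (wP n * info P z)) ^ n with hZdef
  set Y : ℕ → ℝ := fun n => (∑ z, Q z * Real.exp (wQ n * info Q z)) ^ L n with hYdef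
  have hZ0 : ∀ n, 0 ≤ Z n := fun n => pow_nonneg
    (Finset.sum_nonneg fun z _ => mul_nonneg (hP.1 z) (Real.exp_nonneg _)) _
  have hY0 : ∀ n, 0 ≤ Y n := fun n => pow_nonneg
    (Finset.sum_nonneg fun z _ => mul_nonneg (hQ.1 z) (Real.exp_nonneg _)) _
  refine ⟨fun n => Real.exp (-(t / 2) * ((L n * H Q - n * H P) / √n)) *
    (Z n ^ ((1 + u n) / 2) * Y n ^ ((1 - u n) / 2)), ?_, ?_⟩
  · have h1 := (Real.continuous_exp.tendsto _).comp (hm.const_mul (-(t / 2)))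
    have h2 := hZ.rpow (hup.div_const 2) (Or.inl (Real.exp_pos _).ne')
    have h3 := hY.rpow (hum.div_const 2) (Or.inl (Real.exp_pos _).ne')
    have h4 := h1.mul (h2.mul h3)
    refine (congrArg (fun l => Tendsto _ atTop (𝓝 l)) ?_).mp h4
    rw [← Real.exp_mul, ← Real.exp_mul, ← Real.exp_add, ← Real.exp_add]
    congr 1
    ring
  · filter_upwards [eventually_gt_atTop 0, hu0.eventually_lt_const one_pos] with n hn hu1
    have hun : 0 < u n := div_pos ht (Real.sqrt_pos.2 (by exact_mod_cast hn))
    have e1 : 1 / (1 + u n) = 1 - wP n := by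
      rw [hwP]
      field_simp
      ring
    have hne : 1 - u n ≠ 0 := by linarith
    have e2 : 1 / (1 - u n) = 1 - wQ n := by
      rw [hwQ]
      field_simp
      ring
    have l1 : wP n < 1 := by
      have : 0 < 1 / (1 + u n) := by positivity
      linarith
    have l2 : wQ n < 1 := by
      have : 0 < 1 / (1 - u n) := one_div_pos.2 (by linarith)
      linarith
    refine (FM_le_rpow_mul_rpow (isProb_iid hP n) (isProb_iid hQ (L n)) hun hu1).trans_eq ?_
    rw [e1, e2, sum_iid_rpow hP n l1, sum_iid_rpow hQ (L n) l2,
      Real.mul_rpow (Real.exp_nonneg _) (hZ0 n), Real.mul_rpow (Real.exp_nonneg _) (hY0 n),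
      ← Real.exp_mul, ← Real.exp_mul]
    have e3 : n * wP n * H P * ((1 + u n) / 2) = n * H P * u n / 2 := by
      rw [hwP]
      field_simp
    have e4 : L n * wQ n * H Q * ((1 - u n) / 2) = -(L n * H Q * u n) / 2 := by
      rw [hwQ]
      field_simp
    have e5 : -(t / 2) * ((L n * H Q - n * H P) / √n)
        = n * H P * u n / 2 + -(L n * H Q * u n) / 2 := by
      rw [hu]
      ring
    rw [e3, e4, e5, Real.exp_add]
    ring

end UpperBound

section LowerBound

open Topology ProbabilityTheory

theorem sqrt_gaussianPDFReal_mul (M : ℝ) (v : NNReal) (x : ℝ) :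
    √(gaussianPDFReal 0 v x) * √(gaussianPDFReal M v x)
      = Real.exp (-M ^ 2 / (8 * v)) * gaussianPDFReal (M / 2) v x := by
  rcases eq_or_ne v 0 with rfl | hv
  · simp
  have hv' : (v : ℝ) ≠ 0 := by exact_mod_cast hv
  rw [← Real.sqrt_mul (gaussianPDFReal_nonneg _ _ _),
    ← Real.sqrt_sq (mul_nonneg (Real.exp_nonneg (-M ^ 2 / (8 * v)))
      (gaussianPDFReal_nonneg (M / 2) v x))]
  congr 1
  have hexp : Real.exp (-(x - 0) ^ 2 / (2 * v)) * Real.exp (-(x - M) ^ 2 / (2 * v))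
      = (Real.exp (-M ^ 2 / (8 * v)) * Real.exp (-(x - M / 2) ^ 2 / (2 * v))) ^ 2 := by
    rw [← Real.exp_add, ← Real.exp_add, ← Real.exp_nat_mul]
    congr 1
    push_cast
    field_simp
    ring
  rw [gaussianPDFReal, gaussianPDFReal, gaussianPDFReal, mul_mul_mul_comm, hexp]
  ring

theorem gaussianReal_real_eq_setIntegral (M : ℝ) {v : NNReal} (hv : v ≠ 0) (s : Set ℝ) :
    (gaussianReal M v).real s = ∫ x in s, gaussianPDFReal M v x := by
  rw [Measure.real, gaussianReal_apply_eq_integral M hv, ENNReal.toReal_ofReal]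
  exact integral_nonneg fun x => gaussianPDFReal_nonneg _ _ _

theorem exp_mul_gaussianReal_le_sqrt (M : ℝ) {v : NNReal} (hv : v ≠ 0) (s : Set ℝ) :
    Real.exp (-M ^ 2 / (8 * v)) * (gaussianReal (M / 2) v).real s
      ≤ √((gaussianReal M v).real s * (gaussianReal 0 v).real s) := by
  have hL : ∀ m, MemLp (fun x => √(gaussianPDFReal m v x)) (ENNReal.ofReal 2)
      (volume.restrict s) := by
    intro m
    rw [ENNReal.ofReal_ofNat, memLp_two_iff_integrable_sq
      (measurable_gaussianPDFReal m v).sqrt.aestronglyMeasurable]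
    simp only [Real.sq_sqrt (gaussianPDFReal_nonneg _ _ _)]
    exact (integrable_gaussianPDFReal m v).restrict
  have key := integral_mul_le_Lp_mul_Lq_of_nonneg Real.HolderConjugate.two_two
    (ae_of_all _ fun x => Real.sqrt_nonneg _) (ae_of_all _ fun x => Real.sqrt_nonneg _)
    (hL 0) (hL M)
  simp only [sqrt_gaussianPDFReal_mul, Real.rpow_two, Real.sq_sqrt (gaussianPDFReal_nonneg _ _ _),
    integral_const_mul, ← gaussianReal_real_eq_setIntegral _ hv, ← Real.sqrt_eq_rpow] at key
  rwa [mul_comm ((gaussianReal M v).real s), Real.sqrt_mul measureReal_nonneg]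

theorem hasSum_gaussianReal_Ico (M : ℝ) (v : NNReal) {h : ℝ} (hh : 0 < h) :
    HasSum (fun k : ℤ => (gaussianReal M v).real (Set.Ico (k * h) ((k + 1) * h))) 1 := by
  have hd : Pairwise (Function.onFun Disjoint
      fun k : ℤ => Set.Ico ((k : ℝ) * h) ((k + 1) * h)) := by
    simpa using Set.pairwise_disjoint_Ico_zsmul h
  have hu : ⋃ k : ℤ, Set.Ico ((k : ℝ) * h) ((k + 1) * h) = Set.univ := by
    simpa using iUnion_Ico_zsmul hh
  have h1 := measure_iUnion (μ := gaussianReal M v) hd fun k => measurableSet_Ico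
  rw [hu, measure_univ] at h1
  have h2 := ENNReal.hasSum_toReal (h1 ▸ ENNReal.one_ne_top)
  rwa [← ENNReal.tsum_toReal_eq fun k => measure_ne_top _ _, ← h1, ENNReal.toReal_one] at h2

theorem iid_le_exp {Z : Type*} [Fintype Z] {R : Z → ℝ} (hR : IsProb R) (n : ℕ) (y : Fin n → Z) :
    iid R n y ≤ Real.exp (-∑ i, info R (y i) - n * H R) := by
  have : Real.exp (-∑ i, info R (y i) - n * H R) = ∏ i, Real.exp (Real.log (R (y i))) := by
    rw [← Real.exp_sum]
    simp [info]
  rw [this]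
  exact Finset.prod_le_prod (fun i _ => hR.1 _) fun i _ => Real.le_exp_log _

theorem iid_eq_exp {Z : Type*} [Fintype Z] {R : Z → ℝ} (hR : IsProb R) {n : ℕ} {y : Fin n → Z}
    (hy : iid R n y ≠ 0) : iid R n y = Real.exp (-∑ i, info R (y i) - n * H R) := by
  have : Real.exp (-∑ i, info R (y i) - n * H R) = ∏ i, Real.exp (Real.log (R (y i))) := by
    rw [← Real.exp_sum]
    simp [info]
  rw [this]
  refine Finset.prod_congr rfl fun i hi => (Real.exp_log ?_).symm
  exact (hR.1 _).lt_of_ne' fun h => hy (Finset.prod_eq_zero hi h)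

/-- Asymptotic lower bound on `FD` with free shift parameter `δ`. -/
theorem eventually_lt_FD {X Y : Type*} [Fintype X] [Fintype Y] {P : X → ℝ} {Q : Y → ℝ}
    (hP : IsProb P) (hQ : IsProb Q) (hVP : 0 < V P) {L : ℕ → ℕ} {κ m δ c : ℝ} (hδ : 0 < δ)
    (hκ : κ * V Q = V P)
    (hL : Tendsto (fun n => (L n : ℝ) / n) atTop (𝓝 κ))
    (hm : Tendsto (fun n : ℕ => (L n * H Q - n * H P) / √n) atTop (𝓝 m))
    (hc : c < Real.exp (-(m + δ) ^ 2 / (8 * V P))) :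
    ∀ᶠ n in atTop, c < FD (iid P n) (iid Q (L n)) := by
  classical
  set v : NNReal := ⟨V P, hVP.le⟩ with hv
  have hv0 : v ≠ 0 := fun h => hVP.ne' (congrArg NNReal.toReal h)
  set h : ℝ := δ / 2 with hh
  have hhpos : 0 < h := by positivity
  set B : ℤ → Set ℝ := fun k => Set.Ico (k * h) ((k + 1) * h) with hB
  obtain ⟨I, hI⟩ : ∃ I : Finset ℤ, c < ∑ k ∈ I,
      Real.exp (-(m + δ) ^ 2 / (8 * V P)) * (gaussianReal ((m + δ) / 2) v).real (B k) := by
    have := (hasSum_gaussianReal_Ico ((m + δ) / 2) v hhpos).mul_left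
      (Real.exp (-(m + δ) ^ 2 / (8 * V P)))
    rw [mul_one] at this
    exact (this.eventually (lt_mem_nhds hc)).exists
  set C : ℕ → ℝ := fun n => (L n * H Q - n * H P) / √n + δ with hC
  set ε : ℕ → ℝ := fun n => Real.exp (-(√n * h)) with hε
  have hε0 : Tendsto ε atTop (𝓝 0) :=
    Real.tendsto_exp_neg_atTop_nhds_zero.comp (tendsto_sqrt_natCast.atTop_mul_const hhpos)
  set p : ℕ → ℤ → ℝ := fun n k => ∑ x : Fin n → X with
    (∑ i, info P (x i)) / √n + 0 ∈ B k, iid P n x with hp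
  set q : ℕ → ℤ → ℝ := fun n k => ∑ y : Fin (L n) → Y with
    (∑ i, info Q (y i)) / √n + C n ∈ B k, iid Q (L n) y with hq
  have hplim : ∀ k, Tendsto (fun n => p n k) atTop (𝓝 ((gaussianReal 0 v).real (B k))) := by
    intro k
    refine (tendsto_sum_iid_Ico hP (k := fun n => n) (κ := 1) ?_ (by rw [one_mul]; rfl) hv0
      (tendsto_const_nhds (x := 0)) _ _).congr fun n => ?_
    · exact tendsto_const_nhds.congr' (by
        filter_upwards [eventually_ne_atTop 0] with n hn
        rw [div_self (by exact_mod_cast hn)])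
    · exact Finset.sum_congr (by ext; simp [hB]) fun _ _ => rfl
  have hqlim : ∀ k, Tendsto (fun n => q n k) atTop (𝓝 ((gaussianReal (m + δ) v).real (B k))) := by
    intro k
    refine (tendsto_sum_iid_Ico hQ hL (v := v) hκ.symm hv0 (hm.add_const δ) _ _).congr fun n => ?_
    exact Finset.sum_congr (by ext; simp [hB, hC]) fun _ _ => rfl
  have hlim : Tendsto (fun n => ∑ k ∈ I, √(q n k * (p n k - ε n * q n k))) atTop
      (𝓝 (∑ k ∈ I, √((gaussianReal (m + δ) v).real (B k) * (gaussianReal 0 v).real (B k)))) := by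
    refine tendsto_finsetSum _ fun k _ => ?_
    have := ((hqlim k).mul ((hplim k).sub (hε0.mul (hqlim k)))).sqrt
    rwa [zero_mul, sub_zero] at this
  have hlt := hI.trans_le (Finset.sum_le_sum fun k _ =>
    exp_mul_gaussianReal_le_sqrt (m + δ) hv0 (B k))
  have hfloor : ∀ (a : ℝ) (k : ℤ), ⌊a / h⌋ = k ↔ a ∈ B k := by
    intro a k
    rw [Int.floor_eq_iff, hB, Set.mem_Ico, le_div_iff₀ hhpos, div_lt_iff₀ hhpos]
  filter_upwards [hlim.eventually (lt_mem_nhds hlt), eventually_gt_atTop 0] with n hn hn0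
  have hs : 0 < √(n : ℝ) := Real.sqrt_pos.2 (by exact_mod_cast hn0)
  refine hn.trans_le ?_
  have key := sum_sqrt_le_FD (isProb_iid hP n) (isProb_iid hQ (L n))
    (fun x => ⌊((∑ i, info P (x i)) / √n + 0) / h⌋)
    (fun y => ⌊((∑ i, info Q (y i)) / √n + C n) / h⌋) I (Real.exp_nonneg (-(√n * h))) ?_
  · simp only [hfloor] at key
    convert key
  · intro x y hxy
    refine or_iff_not_imp_right.2 fun hy => ?_
    rw [iid_eq_exp hQ hy, ← Real.exp_add]
    refine (iid_le_exp hP n x).trans (Real.exp_le_exp.2 ?_)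
    have h1 := Int.abs_sub_lt_one_of_floor_eq_floor hxy
    rw [← sub_div, abs_lt, neg_lt, ← neg_div, div_lt_one hhpos] at h1
    have h2 := mul_lt_mul_of_pos_left h1.1 hs
    have h3 : √n * -((∑ i, info P (x i)) / √n + 0 - ((∑ i, info Q (y i)) / √n + C n))
        = -(∑ i, info P (x i)) + ∑ i, info Q (y i) + (L n * H Q - n * H P) + √n * δ := by
      rw [hC]
      field_simp
      ring
    rw [h3] at h2
    have h4 : √(n : ℝ) * δ = √n * h + √n * h := by
      rw [hh]
      ring
    linarith

end LowerBound

section SecondOrder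

open Topology

theorem H_pos_of_V_pos {Z : Type*} [Fintype Z] {R : Z → ℝ} (hR : IsProb R) (hV : 0 < V R) :
    0 < H R := by
  have h1 : ∀ z, 0 ≤ -(R z * Real.log (R z)) := fun z => by
    have hz : R z ≤ 1 := hR.2 ▸ Finset.single_le_sum (fun z _ => hR.1 z) (Finset.mem_univ z)
    exact neg_nonneg.2 (mul_nonpos_of_nonneg_of_nonpos (hR.1 z) (Real.log_nonpos (hR.1 z) hz))
  refine (Finset.sum_nonneg fun z _ => h1 z).lt_of_ne fun h0 => hV.ne' ?_
  have h0' : H R = 0 := h0.symm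
  rw [V, h0']
  refine Finset.sum_eq_zero fun z hz => ?_
  have := (Finset.sum_eq_zero_iff_of_nonneg fun z _ => h1 z).1 h0.symm z hz
  linear_combination -Real.log (R z) * this

theorem tendsto_floor_div {κ : ℝ} (hκ : 0 < κ) (b : ℝ) :
    Tendsto (fun n : ℕ => ((⌊κ * n + b * √n⌋₊ : ℕ) - κ * n) / √n) atTop (𝓝 b) := by
  have hz : Tendsto (fun n : ℕ => 1 / √(n : ℝ)) atTop (𝓝 0) :=
    tendsto_const_nhds.div_atTop tendsto_sqrt_natCast
  have hlow : Tendsto (fun n : ℕ => b - 1 / √(n : ℝ)) atTop (𝓝 b) := by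
    simpa using hz.const_sub b
  have hbig : ∀ᶠ n : ℕ in atTop, -b ≤ κ * √(n : ℝ) :=
    (tendsto_sqrt_natCast.const_mul_atTop hκ).eventually_ge_atTop (-b)
  refine tendsto_of_tendsto_of_tendsto_of_le_of_le' hlow tendsto_const_nhds ?_ ?_
  · filter_upwards [eventually_gt_atTop 0] with n hn
    have hs : 0 < √(n : ℝ) := Real.sqrt_pos.2 (by exact_mod_cast hn)
    have := Nat.lt_floor_add_one (κ * n + b * √n)
    rw [le_div_iff₀ hs, sub_mul, div_mul_cancel₀ _ hs.ne']
    linarith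
  · filter_upwards [eventually_gt_atTop 0, hbig] with n hn hb
    have hs : 0 < √(n : ℝ) := Real.sqrt_pos.2 (by exact_mod_cast hn)
    have h0 : 0 ≤ κ * n + b * √n := by
      have := mul_nonneg (show 0 ≤ κ * √(n : ℝ) + b by linarith) hs.le
      rwa [add_mul, mul_assoc, Real.mul_self_sqrt (Nat.cast_nonneg n)] at this
    have := Nat.floor_le h0
    rw [div_le_iff₀ hs]
    linarith

theorem tendsto_div_of_tendsto_sub_div_sqrt {L : ℕ → ℕ} {κ b : ℝ}
    (h : Tendsto (fun n : ℕ => (L n - κ * n) / √n) atTop (𝓝 b)) :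
    Tendsto (fun n => (L n : ℝ) / n) atTop (𝓝 κ) := by
  have h1 := (h.div_atTop tendsto_sqrt_natCast).const_add κ
  rw [add_zero] at h1
  refine h1.congr' ?_
  filter_upwards [eventually_gt_atTop 0] with n hn
  have hn' : (0 : ℝ) < n := by exact_mod_cast hn
  rw [div_div, Real.mul_self_sqrt hn'.le]
  field_simp
  ring

/-- Lower bound on `FD` below the limiting value. -/
theorem eventually_lt_FD_of_lt {X Y : Type*} [Fintype X] [Fintype Y] {P : X → ℝ} {Q : Y → ℝ}
    (hP : IsProb P) (hQ : IsProb Q) (hVP : 0 < V P) {L : ℕ → ℕ} {κ m c : ℝ}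
    (hκ : κ * V Q = V P)
    (hL : Tendsto (fun n => (L n : ℝ) / n) atTop (𝓝 κ))
    (hm : Tendsto (fun n : ℕ => (L n * H Q - n * H P) / √n) atTop (𝓝 m))
    (hc : c < if 0 < m then Real.exp (-m ^ 2 / (8 * V P)) else 1) :
    ∀ᶠ n in atTop, c < FD (iid P n) (iid Q (L n)) := by
  set δ₀ : ℝ := max (-m) 0 with hδ₀
  have hlim : Tendsto (fun δ : ℝ => Real.exp (-(m + δ) ^ 2 / (8 * V P))) (𝓝[>] δ₀)
      (𝓝 (Real.exp (-(m + δ₀) ^ 2 / (8 * V P)))) :=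
    ((by fun_prop : Continuous fun δ : ℝ => Real.exp (-(m + δ) ^ 2 / (8 * V P))).tendsto
      δ₀).mono_left nhdsWithin_le_nhds
  have hval : Real.exp (-(m + δ₀) ^ 2 / (8 * V P))
      = if 0 < m then Real.exp (-m ^ 2 / (8 * V P)) else 1 := by
    split_ifs with h
    · rw [hδ₀, max_eq_right (by linarith), add_zero]
    · rw [hδ₀, max_eq_left (by linarith)]
      simp
  rw [hval] at hlim
  obtain ⟨δ, hδc, hδ⟩ := ((hlim.eventually (lt_mem_nhds hc)).and self_mem_nhdsWithin).exists
  exact eventually_lt_FD hP hQ hVP ((le_max_right _ _).trans_lt hδ) hκ hL hm hδc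

/-- Upper bound on `FM` above the limiting value. -/
theorem eventually_FM_lt_of_lt {X Y : Type*} [Fintype X] [Fintype Y] {P : X → ℝ} {Q : Y → ℝ}
    (hP : IsProb P) (hQ : IsProb Q) (hVP : 0 < V P) {L : ℕ → ℕ} {κ m c : ℝ}
    (hκ : κ * V Q = V P)
    (hL : Tendsto (fun n => (L n : ℝ) / n) atTop (𝓝 κ))
    (hm : Tendsto (fun n : ℕ => (L n * H Q - n * H P) / √n) atTop (𝓝 m))
    (hc : (if 0 < m then Real.exp (-m ^ 2 / (8 * V P)) else 1) < c) :
    ∀ᶠ n in atTop, FM (iid P n) (iid Q (L n)) < c := by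
  split_ifs at hc with h
  · obtain ⟨B, hB, hle⟩ := exists_tendsto_FM_le hP hQ (t := m / (2 * V P)) (by positivity) hL hm
    have he : -(m / (2 * V P) * m) / 2 + (V P + κ * V Q) * (m / (2 * V P)) ^ 2 / 4
        = -m ^ 2 / (8 * V P) := by
      rw [hκ]
      field_simp
      ring
    rw [he] at hB
    filter_upwards [hle, hB.eventually (gt_mem_nhds hc)] with n h1 h2 using h1.trans_lt h2
  · exact Eventually.of_forall fun n => (FM_le_one _ (isProb_iid hQ _)).trans_lt hc

end SecondOrder

/-- second order asymptotics in the case `H(P)/V(P) = H(Q)/V(Q)`. -/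
theorem second_order_case_eq {X Y : Type*} [Fintype X] [Fintype Y]
    (P : X → ℝ) (Q : Y → ℝ) (hP : IsProb P) (hQ : IsProb Q)
    (hVP : 0 < V P) (hVQ : 0 < V Q)
    (hratio : H P / V P = H Q / V Q) (b : ℝ) :
    Tendsto (fun n : ℕ =>
        FD (iid P n) (iid Q ⌊H P / H Q * n + b * Real.sqrt n⌋₊)) atTop
      (nhds (if 0 < b then Real.exp (-(H Q * b) ^ 2 / (8 * V P)) else 1)) ∧
    Tendsto (fun n : ℕ =>
        FM (iid P n) (iid Q ⌊H P / H Q * n + b * Real.sqrt n⌋₊)) atTop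
      (nhds (if 0 < b then Real.exp (-(H Q * b) ^ 2 / (8 * V P)) else 1)) := by
  have hHP := H_pos_of_V_pos hP hVP
  have hHQ := H_pos_of_V_pos hQ hVQ
  have hκ : H P / H Q * V Q = V P := by
    rw [div_eq_div_iff hVP.ne' hVQ.ne'] at hratio
    field_simp
    linarith
  have hb := tendsto_floor_div (div_pos hHP hHQ) b
  have hL := tendsto_div_of_tendsto_sub_div_sqrt hb
  have hm := hb.mul_const (H Q)
  replace hm := hm.congr (f₂ := fun n : ℕ =>
    ((⌊H P / H Q * n + b * √n⌋₊ : ℕ) * H Q - n * H P) / √n) fun n => by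
      field_simp
  rw [mul_comm b] at hm
  have hle : ∀ n, FD (iid P n) (iid Q ⌊H P / H Q * n + b * √n⌋₊)
      ≤ FM (iid P n) (iid Q ⌊H P / H Q * n + b * √n⌋₊) :=
    fun n => FD_le_FM (isProb_iid hP _) (isProb_iid hQ _)
  rw [if_congr (mul_pos_iff_of_pos_left hHQ (b := b)).symm rfl rfl]
  have hlow := fun c hc => eventually_lt_FD_of_lt hP hQ hVP (c := c) hκ hL hm hc
  have hup := fun c hc => eventually_FM_lt_of_lt hP hQ hVP (c := c) hκ hL hm hc
  refine ⟨tendsto_order.2 ⟨hlow, fun c hc => ?_⟩, tendsto_order.2 ⟨fun c hc => ?_, hup⟩⟩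
  · filter_upwards [hup c hc] with n hn using (hle n).trans_lt hn
  · filter_upwards [hlow c hc] with n hn using hn.trans_le (hle n)

end RNG
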